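/- arXiv:1708.05755 — 2 statements merged into one kernel-verified Lean document; each statement's English description precedes it below -/
import Mathlib

section
/- Suppose f is a continuous interval map with zero topological entropy and x ∈ I has infinite ω-limit set K = ω(x). Then x is mean-attracted to K: for every ε > 0 there exists z ∈ K with limsup_{N→∞} (1/N) Σ_{n=1}^{N} |fⁿx − fⁿz| < ε. -/
open Filter Dynamics

/-- A set containing two uniformly separated pieces, each mapped by `f^[m]` onto a superset of
the whole set, carries positive entropy. -/
lemma coverEntropy_pos_of_horseshoe {X : Type*} [PseudoMetricSpace X] {f : X → X} {F S : Set X}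
    {m : ℕ} (hm : m ≠ 0) (hSF : S ⊆ F) (hS : S.Nonempty) {A : Bool → Set X}
    (hAS : ∀ i, A i ⊆ S) {δ : ℝ} (hδ : 0 < δ)
    (hsep : ∀ i j, i ≠ j → ∀ u ∈ A i, ∀ v ∈ A j, δ ≤ dist u v)
    (hcov : ∀ i, ∀ y ∈ S, ∃ u ∈ A i, f^[m] u = y) : 0 < coverEntropy f F := by
  have words : ∀ n : ℕ, ∃ φ : (Fin n → Bool) → X,
      ∀ w, φ w ∈ S ∧ ∀ i : Fin n, f^[m * i] (φ w) ∈ A (w i) := by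
    intro n
    induction n with
    | zero => exact ⟨fun _ => hS.some, fun w => ⟨hS.some_mem, fun i => i.elim0⟩⟩
    | succ n ih =>
      obtain ⟨φ, hφ⟩ := ih
      have h : ∀ w : Fin (n + 1) → Bool, ∃ u ∈ A (w 0), f^[m] u = φ (Fin.tail w) :=
        fun w => hcov _ _ (hφ _).1
      choose ψ hψA hψ using h
      refine ⟨ψ, fun w => ⟨hAS _ (hψA w), fun i => ?_⟩⟩
      refine Fin.cases ?_ (fun j => ?_) i
      · simpa using hψA w
      · have := (hφ (Fin.tail w)).2 j
        rw [← hψ w, ← Function.iterate_add_apply] at this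
        simpa [Fin.tail, mul_add] using this
  let U : SetRel X X := {p | dist p.1 p.2 < δ / 2}
  have hU : U ∈ uniformity X := Metric.dist_mem_uniformity (half_pos hδ)
  have hcard : ∀ n : ℕ, ((2 : ENNReal) ^ n) ≤ (netMaxcard f F U (m * n) : ENNReal) := by
    intro n
    obtain ⟨φ, hφ⟩ := words n
    have hdisj : ∀ w w', w ≠ w' → Disjoint (UniformSpace.ball (φ w) (dynEntourage f U (m * n)))
        (UniformSpace.ball (φ w') (dynEntourage f U (m * n))) := by
      intro w w' hw
      obtain ⟨i, hi⟩ := Function.ne_iff.1 hw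
      rw [Set.disjoint_left]
      intro y hy hy'
      have hlt : m * i < m * n := Nat.mul_lt_mul_of_pos_left i.2 (Nat.pos_of_ne_zero hm)
      have h1 := mem_ball_dynEntourage.1 hy _ hlt
      have h2 := mem_ball_dynEntourage.1 hy' _ hlt
      simp only [UniformSpace.ball, Set.mem_preimage, U, Set.mem_ofPred_eq] at h1 h2
      have h3 := hsep _ _ hi _ ((hφ w).2 i) _ ((hφ w').2 i)
      have h4 := dist_triangle_right (f^[m * i] (φ w)) (f^[m * i] (φ w')) (f^[m * i] y)
      linarith
    have hinj : Function.Injective φ := by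
      intro w w' h
      by_contra hw
      have hmem : φ w ∈ UniformSpace.ball (φ w) (dynEntourage f U (m * n)) := by
        rw [mem_ball_dynEntourage]
        intro k _
        simp [UniformSpace.ball, U, hδ]
      exact Set.disjoint_left.1 (hdisj w w' hw) hmem (h ▸ hmem)
    have hnet : IsDynNetIn f F U (m * n) (Finset.univ.map ⟨φ, hinj⟩ : Finset X) := by
      refine ⟨?_, ?_⟩
      · intro y hy
        obtain ⟨w, -, rfl⟩ := Finset.mem_map.1 (Finset.mem_coe.1 hy)
        exact hSF (hφ w).1
      · intro y hy y' hy' hne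
        obtain ⟨w, -, rfl⟩ := Finset.mem_map.1 (Finset.mem_coe.1 hy)
        obtain ⟨w', -, rfl⟩ := Finset.mem_map.1 (Finset.mem_coe.1 hy')
        exact hdisj w w' (fun h => hne (by rw [h]))
    have := hnet.card_le_netMaxcard
    rw [Finset.card_map, Finset.card_univ, Fintype.card_fun, Fintype.card_bool,
      Fintype.card_fin] at this
    have := ENat.toENNReal_mono this
    simpa using this
  have hgrow := ExpGrowth.expGrowthSup_monotone hcard
  have hmono : Monotone fun n : ℕ => (netMaxcard f F U n : ENNReal) :=
    fun _ _ h => ENat.toENNReal_mono (netMaxcard_monotone_time f F U h)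
  rw [ExpGrowth.expGrowthSup_pow, hmono.expGrowthSup_comp_mul hm] at hgrow
  have hlog : (0 : EReal) < ENNReal.log 2 := by
    rw [ENNReal.zero_lt_log_iff]; exact ENNReal.one_lt_two
  by_contra hneg
  have hle : netEntropyEntourage f F U ≤ 0 :=
    (netEntropyEntourage_le_coverEntropy f F hU).trans (not_lt.1 hneg)
  have : (m : EReal) * netEntropyEntourage f F U ≤ 0 :=
    mul_nonpos_of_nonneg_of_nonpos (by exact_mod_cast Nat.zero_le m) hle
  exact absurd (hlog.trans_le (hgrow.trans this)) (lt_irrefl _)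

/-- No interval with one fixed endpoint folds over itself twice under `F`, on either side. -/
def FoldFree (F : ℝ → ℝ) : Prop :=
  ∀ p b c, F p = p →
    (p < c → c < b → F b ≤ p → b ≤ F c → False) ∧ (b < c → c < p → p ≤ F b → F c ≤ b → False)

/-- The conjugate of a map of the line by the reflection `t ↦ -t`. -/
def reflectMap (F : ℝ → ℝ) : ℝ → ℝ := fun t => -F (-t)

lemma FoldFree.reflect {F : ℝ → ℝ} (h : FoldFree F) : FoldFree (reflectMap F) := by
  intro p b c hp
  have hp' : F (-p) = -p := by unfold reflectMap at hp; linarith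
  obtain ⟨h1, h2⟩ := h (-p) (-b) (-c) hp'
  unfold reflectMap
  constructor
  · intro a1 a2 a3 a4
    exact h2 (by linarith) (by linarith) (by linarith) (by linarith)
  · intro a1 a2 a3 a4
    exact h1 (by linarith) (by linarith) (by linarith) (by linarith)

lemma continuous_reflectMap {F : ℝ → ℝ} (h : Continuous F) : Continuous (reflectMap F) := by
  unfold reflectMap; fun_prop

lemma reflectMap_reflectMap (F : ℝ → ℝ) (t : ℝ) : reflectMap F (reflectMap F t) = -F (F (-t)) := by
  simp [reflectMap]

lemma exists_separated_covers {G : ℝ → ℝ} (hG : Continuous G) {p c b : ℝ} (hp : G p = p)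
    (hpc : p < c) (hcb : c < b) (hb : G b ≤ p) (hc : b ≤ G c) :
    ∃ e e', p ≤ e ∧ e < e' ∧ e' ≤ b ∧
      (∀ y ∈ Set.Icc p b, ∃ u ∈ Set.Icc p e, G (G u) = y) ∧
      (∀ y ∈ Set.Icc p b, ∃ u ∈ Set.Icc e' b, G (G u) = y) := by
  obtain ⟨e, ⟨he1, he2⟩, he⟩ := intermediate_value_Icc hpc.le hG.continuousOn
    (show c ∈ Set.Icc (G p) (G c) from ⟨by linarith, by linarith⟩)
  obtain ⟨e', ⟨he1', he2'⟩, he'⟩ := intermediate_value_Icc' hcb.le hG.continuousOn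
    (show c ∈ Set.Icc (G b) (G c) from ⟨by linarith, by linarith⟩)
  obtain ⟨q, ⟨hq1, hq2⟩, hq⟩ := intermediate_value_Icc' he2' hG.continuousOn
    (show p ∈ Set.Icc (G b) (G e') from ⟨by linarith, by linarith⟩)
  have hne : e ≠ c := by rintro rfl; linarith
  have hlt : e < c := lt_of_le_of_ne he2 hne
  have hGG : Continuous fun t => G (G t) := hG.comp hG
  refine ⟨e, e', he1, by linarith, he2', fun y hy => ?_, fun y hy => ?_⟩
  · exact intermediate_value_Icc he1 hGG.continuousOn
      ⟨by simp only [hp]; exact hy.1, by simp only [he]; linarith [hy.2]⟩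
  · obtain ⟨u, hu, huy⟩ := intermediate_value_Icc' hq1 hGG.continuousOn
      (show y ∈ Set.Icc (G (G q)) (G (G e')) from
        ⟨by rw [hq, hp]; exact hy.1, by rw [he']; linarith [hy.2]⟩)
    exact ⟨u, ⟨hu.1, hu.2.trans hq2⟩, huy⟩

lemma foldFree_iterate {f F : ℝ → ℝ} {a b : ℝ} (hF : Continuous F)
    (hmaps : ∀ t, F t ∈ Set.Icc a b) (heq : Set.EqOn f F (Set.Icc a b))
    (hent : coverEntropy f (Set.Icc a b) = 0) {k : ℕ} (hk : k ≠ 0) : FoldFree F^[k] := by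
  have hiter : ∀ n, ∀ t ∈ Set.Icc a b, f^[n] t = F^[n] t := by
    intro n
    induction n with
    | zero => intro t _; rfl
    | succ n ih =>
      intro t ht
      rw [Function.iterate_succ_apply, Function.iterate_succ_apply, heq ht]
      exact ih _ (hmaps t)
  have hmapsk : ∀ t, F^[k] t ∈ Set.Icc a b := by
    intro t
    obtain ⟨l, rfl⟩ := Nat.exists_eq_succ_of_ne_zero hk
    rw [Function.iterate_succ_apply']
    exact hmaps _
  have key : ∀ (S A B : Set ℝ) (δ : ℝ), S ⊆ Set.Icc a b → S.Nonempty → A ⊆ S → B ⊆ S → 0 < δ →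
      (∀ u ∈ A, ∀ v ∈ B, δ ≤ dist u v) → (∀ y ∈ S, ∃ u ∈ A, F^[k] (F^[k] u) = y) →
      (∀ y ∈ S, ∃ u ∈ B, F^[k] (F^[k] u) = y) → False := by
    intro S A B δ hS hne hA hB hδ hsep hcA hcB
    refine (coverEntropy_pos_of_horseshoe (f := f) (m := k + k) (by omega) hS hne
      (A := fun i => if i then A else B) ?_ hδ ?_ ?_).ne' hent
    · rintro (_ | _) <;> simpa
    · rintro (_ | _) (_ | _) h u hu v hv
      · exact absurd rfl h
      · rw [dist_comm]; exact hsep v hv u hu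
      · exact hsep u hu v hv
      · exact absurd rfl h
    · rintro (_ | _) y hy
      · obtain ⟨u, hu, huy⟩ := hcB y hy
        refine ⟨u, hu, ?_⟩
        rw [hiter _ u (hS (hB hu)), Function.iterate_add_apply, huy]
      · obtain ⟨u, hu, huy⟩ := hcA y hy
        refine ⟨u, hu, ?_⟩
        rw [hiter _ u (hS (hA hu)), Function.iterate_add_apply, huy]
  intro p q c hp
  constructor
  · intro h1 h2 h3 h4
    obtain ⟨e, e', he, hee, he', hA, hB⟩ :=
      exists_separated_covers (hF.iterate k) hp h1 h2 h3 h4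
    refine key (Set.Icc p q) (Set.Icc p e) (Set.Icc e' q) (e' - e) ?_ ⟨p, le_refl _, by linarith⟩
      (Set.Icc_subset_Icc_right (by linarith)) (Set.Icc_subset_Icc_left (by linarith))
      (by linarith) ?_ hA hB
    · exact Set.Icc_subset_Icc (hp ▸ (hmapsk p).1) (h4.trans (hmapsk c).2)
    · intro u hu v hv
      rw [dist_comm, Real.dist_eq]
      exact le_trans (by linarith [hu.2, hv.1]) (le_abs_self _)
  · intro h1 h2 h3 h4
    obtain ⟨e, e', he, hee, he', hA, hB⟩ :=
      exists_separated_covers (G := reflectMap F^[k]) (continuous_reflectMap (hF.iterate k))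
        (p := -p) (c := -c) (b := -q) (by simp [reflectMap, hp]) (by linarith) (by linarith)
        (by simpa [reflectMap] using h3) (by simpa [reflectMap] using h4)
    refine key (Set.Icc q p) (Set.Icc (-e) p) (Set.Icc q (-e')) (e' - e) ?_
      ⟨p, by linarith, le_refl _⟩
      (Set.Icc_subset_Icc_left (by linarith)) (Set.Icc_subset_Icc_right (by linarith))
      (by linarith) ?_ ?_ ?_
    · exact Set.Icc_subset_Icc ((hmapsk c).1.trans h4) (hp ▸ (hmapsk p).2)
    · intro u hu v hv
      rw [Real.dist_eq]
      exact le_trans (by linarith [hu.1, hv.2]) (le_abs_self _)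
    · intro y hy
      obtain ⟨u, hu, huy⟩ := hA (-y) ⟨by linarith [hy.2], by linarith [hy.1]⟩
      rw [reflectMap_reflectMap] at huy
      exact ⟨-u, ⟨by linarith [hu.2], by linarith [hu.1]⟩, by linarith⟩
    · intro y hy
      obtain ⟨u, hu, huy⟩ := hB (-y) ⟨by linarith [hy.2], by linarith [hy.1]⟩
      rw [reflectMap_reflectMap] at huy
      exact ⟨-u, ⟨by linarith [hu.2], by linarith [hu.1]⟩, by linarith⟩

section Orbit

variable {F : ℝ → ℝ} {x : ℕ → ℝ}

lemma FoldFree.le_of_crossing (h : FoldFree F) (hx : ∀ n, x (n + 1) = F (x n)) {p : ℝ}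
    (hp : F p = p) {k i : ℕ} (hki : k ≤ i) (hlt : ∀ j, k ≤ j → j ≤ i → x j < p)
    (hcross : p ≤ x (i + 1)) : x k ≤ x i := by
  by_contra! hcon
  have : ∀ l, k ≤ l → l ≤ i → x i < x l := by
    intro l hl
    induction l, hl using Nat.le_induction with
    | base => exact fun _ => hcon
    | succ l hl ih =>
      intro hli
      by_contra! hle
      refine (h p (x i) (x l) hp).2 (ih (by omega)) (hlt l hl (by omega)) ?_ ?_
      · rwa [← hx]
      · rwa [← hx]
  exact lt_irrefl _ (this i hki le_rfl)

lemma FoldFree.rising_le_of_falling_before (h : FoldFree F) (hF : Continuous F)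
    (hx : ∀ n, x (n + 1) = F (x n)) {n m : ℕ} (hnm : n < m) (hn : x (n + 1) < x n)
    (hm : x m < x (m + 1)) : x m ≤ x n := by
  by_contra! hlt
  let S : Set ℝ := {t | x n ≤ t ∧ t ≤ F t}
  have hS : IsClosed S := (isClosed_le continuous_const continuous_id).inter
    (isClosed_le continuous_id hF)
  have hmS : x m ∈ S := ⟨hlt.le, by rw [← hx]; exact hm.le⟩
  have hbdd : BddBelow S := ⟨x n, fun t ht => ht.1⟩
  have hpS : sInf S ∈ S := hS.csInf_mem ⟨_, hmS⟩ hbdd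
  set p := sInf S
  have hbelow : ∀ t, x n ≤ t → t < p → F t < t := by
    intro t h1 h2
    by_contra! h3
    exact absurd (csInf_le hbdd (show t ∈ S from ⟨h1, h3⟩)) (not_le.2 h2)
  have hnF : F (x n) < x n := by rwa [← hx]
  have hnp : x n < p := lt_of_le_of_ne hpS.1 (fun he => absurd hpS.2 (by rw [← he]; linarith))
  have hp : F p = p := by
    refine le_antisymm ?_ hpS.2
    have hcl : p ∈ closure (Set.Ioo (x n) p) := by
      rw [closure_Ioo hnp.ne]; exact ⟨hnp.le, le_rfl⟩
    exact closure_minimal (t := {t | F t ≤ t}) (fun t ht => (hbelow t ht.1.le ht.2).le)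
      (isClosed_le hF continuous_id) hcl
  have hpm : p ≤ x m := csInf_le hbdd hmS
  have hex : ∃ i, n ≤ i ∧ p ≤ x (i + 1) := ⟨m - 1, by omega, by
    rwa [Nat.sub_add_cancel (by omega)]⟩
  classical
  obtain ⟨hi1, hi2⟩ := Nat.find_spec hex
  set i := Nat.find hex
  have hmin : ∀ j, n ≤ j → j ≤ i → x j < p := by
    intro j hj hji
    rcases hj.eq_or_lt with rfl | hj
    · exact hnp
    · by_contra! hpj
      have := Nat.find_min' hex (m := j - 1)
        ⟨by omega, by rwa [Nat.sub_add_cancel (by omega)]⟩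
      omega
  have h1 := h.le_of_crossing hx hp hi1 hmin hi2
  have h2 := hbelow (x i) h1 (hmin i hi1 le_rfl)
  rw [← hx] at h2
  linarith [hmin i hi1 le_rfl]

lemma FoldFree.rising_le_falling (h : FoldFree F) (hF : Continuous F)
    (hx : ∀ n, x (n + 1) = F (x n)) {n m : ℕ} (hn : x (n + 1) < x n)
    (hm : x m < x (m + 1)) : x m ≤ x n := by
  rcases lt_trichotomy n m with hnm | rfl | hnm
  · exact h.rising_le_of_falling_before hF hx hnm hn hm
  · exact le_rfl
  · have := h.reflect.rising_le_of_falling_before (x := fun k => -x k) (continuous_reflectMap hF)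
      (fun k => by simp [reflectMap, hx]) hnm (by linarith) (by linarith)
    linarith

lemma exists_tendsto_of_eventually_le_succ {b : ℝ} (hb : ∀ n, x n ≤ b) {N : ℕ}
    (hN : ∀ n ≥ N, x n ≤ x (n + 1)) : ∃ l, Tendsto x atTop (nhds l) := by
  have hmono : Monotone fun n => x (n + N) :=
    monotone_nat_of_le_succ fun n => by
      have := hN (n + N) (by omega)
      rwa [show n + 1 + N = n + N + 1 by omega]
  exact ⟨_, (tendsto_add_atTop_iff_nat N).1
    (tendsto_atTop_ciSup hmono ⟨b, by rintro _ ⟨n, rfl⟩; exact hb _⟩)⟩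

lemma exists_tendsto_of_eventually_succ_le {a : ℝ} (ha : ∀ n, a ≤ x n) {N : ℕ}
    (hN : ∀ n ≥ N, x (n + 1) ≤ x n) : ∃ l, Tendsto x atTop (nhds l) := by
  obtain ⟨l, hl⟩ := exists_tendsto_of_eventually_le_succ (x := fun n => -x n) (b := -a)
    (fun n => by linarith [ha n]) (N := N) (fun n hn => by linarith [hN n hn])
  exact ⟨-l, by simpa using hl.neg⟩

/-- A nonconvergent orbit moves monotonically towards a fixed point from either side. -/
lemma FoldFree.exists_separating_fixedPt (h : FoldFree F) (hF : Continuous F)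
    (hx : ∀ n, x (n + 1) = F (x n)) {a b : ℝ} (hab : ∀ n, x n ∈ Set.Icc a b)
    (hconv : ¬ ∃ l, Tendsto x atTop (nhds l)) :
    ∃ z, F z = z ∧ ∀ n, (x n < z ∧ x n < x (n + 1)) ∨ (z < x n ∧ x (n + 1) < x n) := by
  have hnofix : ∀ z, F z = z → ∀ n, x n ≠ z := by
    intro z hz n hn
    refine hconv ⟨z, tendsto_atTop_of_eventually_const (i₀ := n) fun k hk => ?_⟩
    induction k, hk using Nat.le_induction with
    | base => exact hn
    | succ k _ ih => rw [hx, ih, hz]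
  have hne : ∀ n, x (n + 1) ≠ x n := fun n hn => hnofix (x n) (by rw [← hx, hn]) n rfl
  obtain ⟨n₀, hn₀⟩ : ∃ n, x n < x (n + 1) := by
    by_contra! hcon
    exact hconv (exists_tendsto_of_eventually_succ_le (fun n => (hab n).1) (N := 0)
      fun n _ => hcon n)
  obtain ⟨m₀, hm₀⟩ : ∃ n, x (n + 1) < x n := by
    by_contra! hcon
    exact hconv (exists_tendsto_of_eventually_le_succ (fun n => (hab n).2) (N := 0)
      fun n _ => hcon n)
  let U : Set ℝ := {t | ∃ n, t = x n ∧ x n < x (n + 1)}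
  let D : Set ℝ := {t | ∃ n, t = x n ∧ x (n + 1) < x n}
  have hUne : U.Nonempty := ⟨_, n₀, rfl, hn₀⟩
  have hDne : D.Nonempty := ⟨_, m₀, rfl, hm₀⟩
  have hUD : ∀ u ∈ U, ∀ d ∈ D, u ≤ d := by
    rintro _ ⟨m, rfl, hm⟩ _ ⟨n, rfl, hn⟩
    exact h.rising_le_falling hF hx hn hm
  have hUb : BddAbove U := ⟨_, fun u hu => hUD u hu _ hDne.some_mem⟩
  have hDb : BddBelow D := ⟨_, fun d hd => hUD _ hUne.some_mem d hd⟩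
  have hsF : sSup U ≤ F (sSup U) :=
    closure_minimal (t := {t | t ≤ F t}) (by
      rintro _ ⟨n, rfl, hn⟩
      show x n ≤ F (x n)
      rw [← hx]; exact hn.le) (isClosed_le continuous_id hF) (csSup_mem_closure hUne hUb)
  have hdF : F (sInf D) ≤ sInf D :=
    closure_minimal (t := {t | F t ≤ t}) (by
      rintro _ ⟨n, rfl, hn⟩
      show F (x n) ≤ x n
      rw [← hx]; exact hn.le) (isClosed_le hF continuous_id) (csInf_mem_closure hDne hDb)
  have hle : sSup U ≤ sInf D := csSup_le hUne fun u hu => le_csInf hDne fun d hd => hUD u hu d hd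
  obtain ⟨z, ⟨hz1, hz2⟩, hz⟩ := intermediate_value_Icc' hle
    (f := fun t => F t - t) (hF.sub continuous_id).continuousOn
    (show (0 : ℝ) ∈ Set.Icc _ _ from ⟨by linarith, by linarith⟩)
  have hz : F z = z := by linarith
  refine ⟨z, hz, fun n => ?_⟩
  rcases (hne n).lt_or_gt with hn | hn
  · have : sInf D ≤ x n := csInf_le hDb ⟨n, rfl, hn⟩
    exact Or.inr ⟨lt_of_le_of_ne (by linarith) (hnofix z hz n).symm, hn⟩
  · have : x n ≤ sSup U := le_csSup hUb ⟨n, rfl, hn⟩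
    exact Or.inl ⟨lt_of_le_of_ne (by linarith) (hnofix z hz n), hn⟩

/-- Once the orbit has moved from `x k` through `x (k + 1) < z` across `z`, it stays above any
level `β ≥ x k` that `F ∘ F` exceeds between `x k` and `z`. -/
lemma lt_of_double_step (hF : Continuous F) (hx : ∀ n, x (n + 1) = F (x n)) {z : ℝ}
    (hz : F z = z) (hsep : ∀ n, (x n < z ∧ x n < x (n + 1)) ∨ (z < x n ∧ x (n + 1) < x n))
    {k : ℕ} (hk0 : x k < z) (hk1 : x (k + 1) < z) (hk2 : z < x (k + 2)) {β : ℝ}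
    (hkβ : x k ≤ β) (hβ : ∀ t, x k < t → t < z → β < F (F t)) (n : ℕ) (hn : k + 2 ≤ n) :
    x n < z → β < x n := by
  have hk01 : x k < x (k + 1) := by
    rcases hsep k with hs | hs
    · exact hs.2
    · linarith [hs.1]
  have key : (x n < z → β < x n) ∧ (z < x n → ∃ c, x k < c ∧ c < z ∧ x n ≤ F c) := by
    induction n, hn using Nat.le_induction with
    | base => exact ⟨fun h => absurd h hk2.not_gt, fun _ => ⟨_, hk01, hk1, (hx _).le⟩⟩
    | succ n hn ih =>
      rcases hsep n with ⟨h1, h2⟩ | ⟨h1, h2⟩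
      · have := ih.1 h1
        exact ⟨fun _ => by linarith, fun _ => ⟨x n, by linarith, h1, (hx n).le⟩⟩
      · obtain ⟨c, hc1, hc2, hc3⟩ := ih.2 h1
        refine ⟨fun _ => ?_, fun _ => ⟨c, hc1, hc2, by linarith⟩⟩
        obtain ⟨t, ⟨ht1, ht2⟩, ht⟩ := intermediate_value_Icc' hc2.le hF.continuousOn
          (show x n ∈ Set.Icc (F z) (F c) from ⟨by linarith, hc3⟩)
        have htz : t ≠ z := by rintro rfl; linarith
        rw [hx, ← ht]
        exact hβ t (by linarith) (lt_of_le_of_ne ht2 htz)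
  exact key.1

lemma FoldFree.eventually_crosses_up (h : FoldFree F^[2]) (hF : Continuous F)
    (hx : ∀ n, x (n + 1) = F (x n)) {a b : ℝ} (hab : ∀ n, x n ∈ Set.Icc a b)
    (hconv : ¬ ∃ l, Tendsto x atTop (nhds l)) {z : ℝ} (hz : F z = z)
    (hsep : ∀ n, (x n < z ∧ x n < x (n + 1)) ∨ (z < x n ∧ x (n + 1) < x n)) :
    ∃ N, ∀ n ≥ N, x n < z → z < x (n + 1) := by
  by_contra! hcon
  have hside : ∀ n, x n < z ∨ z < x n := fun n => (hsep n).imp And.left And.left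
  have habove : ∀ N, ∃ n ≥ N, z < x n := by
    by_contra! hN
    obtain ⟨N, hN⟩ := hN
    refine hconv (exists_tendsto_of_eventually_le_succ (fun n => (hab n).2) (N := N) ?_)
    intro n hn
    rcases hsep n with hs | hs
    · exact hs.2.le
    · exact absurd hs.1 (hN n hn).not_gt
  have hbelow : ∀ N, ∃ n ≥ N, x n < z := fun N => by
    obtain ⟨n, hn, hn', -⟩ := hcon N
    exact ⟨n, hn, hn'⟩
  have hdouble : ∀ N, ∃ k ≥ N, x k < z ∧ x (k + 1) < z ∧ z < x (k + 2) := by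
    intro N
    obtain ⟨n, hn, hn0, hn1⟩ := hcon N
    have hn1 : x (n + 1) < z := (hside (n + 1)).resolve_right hn1.not_gt
    have hex : ∃ i, z < x (n + 2 + i) := by
      obtain ⟨m, hm, hm'⟩ := habove (n + 2)
      exact ⟨m - (n + 2), by rwa [Nat.add_sub_cancel' hm]⟩
    classical
    have hi := Nat.find_spec hex
    have hmin : ∀ j < Nat.find hex, x (n + 2 + j) < z := fun j hj =>
      (hside _).resolve_right (Nat.find_min hex hj)
    generalize Nat.find hex = i at hi hmin
    have hall : ∀ j < i + 2, x (n + j) < z := by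
      intro j hj
      match j with
      | 0 => exact hn0
      | 1 => exact hn1
      | j + 2 =>
        have := hmin j (by omega)
        rwa [show n + 2 + j = n + (j + 2) by ring] at this
    exact ⟨n + i, by omega, hall i (by omega), hall (i + 1) (by omega),
      by rwa [show n + i + 2 = n + 2 + i by ring]⟩
  let B : Set ℝ := {t | ∃ k, t = x k ∧ x k < z ∧ x (k + 1) < z ∧ z < x (k + 2)}
  have hBne : B.Nonempty := by
    obtain ⟨k, -, hk⟩ := hdouble 0
    exact ⟨_, k, rfl, hk⟩
  have hBz : ∀ t ∈ B, t < z := by rintro _ ⟨k, rfl, hk, -⟩; exact hk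
  have hBb : BddAbove B := ⟨z, fun t ht => (hBz t ht).le⟩
  have hFF : Continuous F^[2] := hF.iterate 2
  have hGz : F^[2] z = z := by simp [hz]
  have hGs : z ≤ F^[2] (sSup B) :=
    closure_minimal (t := {t | z ≤ F^[2] t}) (by
      rintro _ ⟨k, rfl, -, -, hk⟩
      show z ≤ F (F (x k))
      rw [← hx, ← hx]; exact hk.le) (isClosed_le continuous_const hFF) (csSup_mem_closure hBne hBb)
  have hsz : sSup B ≤ z := csSup_le hBne fun t ht => (hBz t ht).le
  set s := sSup B
  rcases hsz.eq_or_lt with hsz | hsz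
  · -- the orbit converges to `z`
    have hlow : ∀ ε > 0, ∃ N, ∀ n ≥ N, z - ε < x n := by
      intro ε hε
      obtain ⟨_, ⟨k, rfl, hk0, hk1, hk2⟩, hkε⟩ := exists_lt_of_lt_csSup hBne
        (show z - ε < sSup B by change z - ε < s; linarith)
      refine ⟨k + 2, fun n hn => ?_⟩
      rcases hside n with hn' | hn'
      · refine hkε.trans (lt_of_double_step hF hx hz hsep hk0 hk1 hk2 le_rfl ?_ n hn hn')
        intro t ht1 ht2
        by_contra! hle
        refine (h z (x k) t hGz).2 ht1 ht2 ?_ hle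
        show z ≤ F (F (x k))
        rw [← hx, ← hx]; exact hk2.le
      · linarith
    refine hconv ⟨z, Metric.tendsto_atTop.2 fun ε hε => ?_⟩
    obtain ⟨δ, hδ, hδε⟩ := Metric.continuousAt_iff.1 (hF.continuousAt (x := z)) ε hε
    obtain ⟨N₁, hN₁⟩ := hlow δ hδ
    obtain ⟨N₂, hN₂⟩ := hlow ε hε
    obtain ⟨M, hM, hMz⟩ := hbelow (max N₁ N₂)
    have hup : ∀ n ≥ M, x n < z + ε := by
      intro n hn
      induction n, hn using Nat.le_induction with
      | base => linarith
      | succ n hn ih =>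
        rcases hsep n with hs | hs
        · have h1 := hN₁ n ((le_max_left _ _).trans (hM.trans hn))
          have := hδε (show dist (x n) z < δ by
            rw [Real.dist_eq, abs_lt]; constructor <;> linarith [hs.1])
          rw [hz, ← hx, Real.dist_eq, abs_lt] at this
          linarith [this.2]
        · linarith [hs.2]
    refine ⟨M, fun n hn => ?_⟩
    rw [Real.dist_eq, abs_lt]
    have h1 := hN₂ n ((le_max_right _ _).trans (hM.trans hn))
    constructor <;> linarith [hup n hn]
  · have hnear : ∀ᶠ t in nhds s, s < F^[2] t :=
      hFF.continuousAt.eventually_const_lt (hsz.trans_le hGs)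
    obtain ⟨η, hη, hnear⟩ := Metric.eventually_nhds_iff.1 hnear
    obtain ⟨_, ⟨k, rfl, hk0, hk1, hk2⟩, hkη⟩ := exists_lt_of_lt_csSup hBne
      (show s - η < sSup B by change s - η < s; linarith)
    have hks : x k ≤ s := le_csSup hBb ⟨k, rfl, hk0, hk1, hk2⟩
    obtain ⟨l, hl, hl0, hl1, hl2⟩ := hdouble (k + 2)
    have hls : x l ≤ s := le_csSup hBb ⟨l, rfl, hl0, hl1, hl2⟩
    refine absurd (lt_of_double_step hF hx hz hsep hk0 hk1 hk2 hks ?_ l hl hl0) hls.not_gt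
    intro t ht1 ht2
    rcases le_or_gt t s with hts | hts
    · exact hnear (by rw [Real.dist_eq, abs_lt]; constructor <;> linarith)
    · by_contra! hle
      exact (h z s t hGz).2 hts ht2 hGs hle

lemma reflectMap_iterate (n : ℕ) (t : ℝ) : (reflectMap F)^[n] t = -F^[n] (-t) := by
  induction n generalizing t with
  | zero => simp
  | succ n ih => rw [Function.iterate_succ_apply, Function.iterate_succ_apply, ih]; simp [reflectMap]

/-- A nonconvergent orbit eventually alternates between the two sides of a point. -/
lemma FoldFree.eventually_alternates (h1 : FoldFree F) (h2 : FoldFree F^[2]) (hF : Continuous F)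
    (hx : ∀ n, x (n + 1) = F (x n)) {a b : ℝ} (hab : ∀ n, x n ∈ Set.Icc a b)
    (hconv : ¬ ∃ l, Tendsto x atTop (nhds l)) :
    ∃ z N, ((∀ n ≥ N, Even n → x n ≤ z) ∧ (∀ n ≥ N, ¬ Even n → z ≤ x n)) ∨
      ((∀ n ≥ N, Even n → z ≤ x n) ∧ (∀ n ≥ N, ¬ Even n → x n ≤ z)) := by
  obtain ⟨z, hz, hsep⟩ := h1.exists_separating_fixedPt hF hx hab hconv
  obtain ⟨N₁, hN₁⟩ := h2.eventually_crosses_up hF hx hab hconv hz hsep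
  have h2' : FoldFree (reflectMap F)^[2] := by
    have : (reflectMap F)^[2] = reflectMap F^[2] := funext fun t => reflectMap_iterate 2 t
    rw [this]; exact h2.reflect
  obtain ⟨N₂, hN₂⟩ := h2'.eventually_crosses_up (x := fun n => -x n) (a := -b) (b := -a) (z := -z)
    (continuous_reflectMap hF) (fun n => by simp [reflectMap, hx])
    (fun n => ⟨by linarith [(hab n).2], by linarith [(hab n).1]⟩)
    (fun ⟨l, hl⟩ => hconv ⟨-l, by simpa using hl.neg⟩) (by simp [reflectMap, hz])
    (fun n => by
      rcases hsep n with hs | hs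
      · exact Or.inr ⟨by linarith [hs.1], by linarith [hs.2]⟩
      · exact Or.inl ⟨by linarith [hs.1], by linarith [hs.2]⟩)
  have hup : ∀ n ≥ max N₁ N₂, x n < z → z < x (n + 1) :=
    fun n hn => hN₁ n ((le_max_left _ _).trans hn)
  have hdown : ∀ n ≥ max N₁ N₂, z < x n → x (n + 1) < z := fun n hn hzn =>
    neg_lt_neg_iff.1 (hN₂ n ((le_max_right _ _).trans hn) (neg_lt_neg hzn))
  generalize max N₁ N₂ = N at hup hdown
  have hpar : ∀ n ≥ 2 * N, (x (2 * N) < z → (Even n → x n < z) ∧ (¬ Even n → z < x n)) ∧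
      (z < x (2 * N) → (Even n → z < x n) ∧ (¬ Even n → x n < z)) := by
    intro n hn
    induction n, hn using Nat.le_induction with
    | base => simp
    | succ n hn ih =>
      have hu := hup n (by omega)
      have hd := hdown n (by omega)
      rw [Nat.even_add_one]
      tauto
  refine ⟨z, 2 * N, ?_⟩
  rcases hsep (2 * N) with hs | hs
  · exact Or.inl ⟨fun n hn he => (((hpar n hn).1 hs.1).1 he).le,
      fun n hn he => (((hpar n hn).1 hs.1).2 he).le⟩
  · exact Or.inr ⟨fun n hn he => (((hpar n hn).2 hs.1).1 he).le,
      fun n hn he => (((hpar n hn).2 hs.1).2 he).le⟩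


/-- For each `n`, the tails of the orbit along the residue classes modulo `2 ^ n` are eventually
linearly ordered as sets. -/
lemma exists_residue_tails_ordered (hF : Continuous F) (hfree : ∀ k ≠ 0, FoldFree F^[k])
    (hx : ∀ n, x (n + 1) = F (x n)) {a b : ℝ} (hab : ∀ n, x n ∈ Set.Icc a b)
    (hconv : ∀ p ≠ 0, ∀ i, ¬ ∃ l, Tendsto (fun k => x (p * k + i)) atTop (nhds l)) (n : ℕ) :
    ∃ N, ∀ r < 2 ^ n, ∀ s < 2 ^ n, r ≠ s →
      (∀ i ≥ N, ∀ j ≥ N, i % 2 ^ n = r → j % 2 ^ n = s → x i ≤ x j) ∨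
      (∀ i ≥ N, ∀ j ≥ N, i % 2 ^ n = r → j % 2 ^ n = s → x j ≤ x i) := by
  have hxadd : ∀ m k, x (k + m) = F^[m] (x k) := by
    intro m k
    induction m with
    | zero => rfl
    | succ m ih => rw [← add_assoc, hx, ih, Function.iterate_succ_apply']
  induction n with
  | zero =>
    refine ⟨0, fun r hr s hs hrs => ?_⟩
    omega
  | succ n ih =>
    obtain ⟨N, hN⟩ := ih
    have hp : 2 ^ n ≠ 0 := by positivity
    have hpow : 2 ^ (n + 1) = 2 ^ n * 2 := pow_succ 2 n
    rw [hpow]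
    generalize 2 ^ n = p at hN hp
    have hppos : 0 < p := Nat.pos_of_ne_zero hp
    have halt := fun r : ℕ => (hfree p hp).eventually_alternates (x := fun k => x (p * k + r))
      (by rw [← Function.iterate_mul]; exact hfree _ (by omega)) (hF.iterate p)
      (fun k => by rw [← hxadd]; congr 1; ring) (fun k => hab _) (hconv p hp r)
    choose z M hM using halt
    refine ⟨N + p * (∑ r ∈ Finset.range p, M r + 1), fun r hr s hs hrs => ?_⟩
    have hmod : ∀ i t, i % (p * 2) = t → i % p = t % p := by
      rintro i _ rfl
      exact (Nat.mod_mod_of_dvd _ (Dvd.intro _ rfl)).symm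
    by_cases hrsp : r % p = s % p
    · have hMle : M (r % p) ≤ ∑ r ∈ Finset.range p, M r :=
        Finset.single_le_sum (f := M) (fun _ _ => Nat.zero_le _)
          (Finset.mem_range.2 (Nat.mod_lt r hppos))
      have hlarge : ∀ i ≥ N + p * (∑ r ∈ Finset.range p, M r + 1), M (r % p) ≤ i / p := by
        intro i hi
        rw [Nat.le_div_iff_mul_le hppos]
        nlinarith
      have hpar : ∀ i t, i % (p * 2) = t → i / p % 2 = t / p := by
        rintro i _ rfl
        exact (Nat.mod_mul_right_div_self i p 2).symm
      have hdec : ∀ i t, i % (p * 2) = t → t % p = r % p → p * (i / p) + r % p = i := by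
        intro i t hi ht
        rw [← ht, ← hmod i t hi, Nat.div_add_mod]
      have hr2 : r / p < 2 := Nat.div_lt_of_lt_mul hr
      have hs2 : s / p < 2 := Nat.div_lt_of_lt_mul hs
      have hne : r / p ≠ s / p := by
        intro h
        apply hrs
        rw [← Nat.div_add_mod r p, ← Nat.div_add_mod s p, h, hrsp]
      have hval : ∀ t, t % p = r % p → (t / p = 0 →
          ∀ i ≥ N + p * (∑ r ∈ Finset.range p, M r + 1), i % (p * 2) = t →
            M (r % p) ≤ i / p ∧ Even (i / p) ∧ p * (i / p) + r % p = i) ∧ (t / p = 1 →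
          ∀ i ≥ N + p * (∑ r ∈ Finset.range p, M r + 1), i % (p * 2) = t →
            M (r % p) ≤ i / p ∧ ¬ Even (i / p) ∧ p * (i / p) + r % p = i) := by
        intro t ht
        constructor
        · intro h0 i hi hit
          exact ⟨hlarge i hi, by rw [Nat.even_iff, hpar i t hit, h0], hdec i t hit ht⟩
        · intro h0 i hi hit
          exact ⟨hlarge i hi, by rw [Nat.even_iff, hpar i t hit, h0]; simp, hdec i t hit ht⟩
      have hrcases : (r / p = 0 ∧ s / p = 1) ∨ (r / p = 1 ∧ s / p = 0) := by
        generalize r / p = u at hr2 hne ⊢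
        generalize s / p = v at hs2 hne ⊢
        omega
      rcases hrcases with ⟨hr0, hs0⟩ | ⟨hr0, hs0⟩ <;>
        rcases hM (r % p) with ⟨hev, hodd⟩ | ⟨hev, hodd⟩
      · left
        intro i hi j hj hir hjs
        obtain ⟨h1, h2, h3⟩ := (hval r rfl).1 hr0 i hi hir
        obtain ⟨h4, h5, h6⟩ := (hval s hrsp.symm).2 hs0 j hj hjs
        rw [← h3, ← h6]
        exact (hev _ h1 h2).trans (hodd _ h4 h5)
      · right
        intro i hi j hj hir hjs
        obtain ⟨h1, h2, h3⟩ := (hval r rfl).1 hr0 i hi hir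
        obtain ⟨h4, h5, h6⟩ := (hval s hrsp.symm).2 hs0 j hj hjs
        rw [← h3, ← h6]
        exact (hodd _ h4 h5).trans (hev _ h1 h2)
      · right
        intro i hi j hj hir hjs
        obtain ⟨h1, h2, h3⟩ := (hval r rfl).2 hr0 i hi hir
        obtain ⟨h4, h5, h6⟩ := (hval s hrsp.symm).1 hs0 j hj hjs
        rw [← h3, ← h6]
        exact (hev _ h4 h5).trans (hodd _ h1 h2)
      · left
        intro i hi j hj hir hjs
        obtain ⟨h1, h2, h3⟩ := (hval r rfl).2 hr0 i hi hir
        obtain ⟨h4, h5, h6⟩ := (hval s hrsp.symm).1 hs0 j hj hjs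
        rw [← h3, ← h6]
        exact (hodd _ h1 h2).trans (hev _ h4 h5)
    · refine (hN (r % p) (Nat.mod_lt _ hppos) (s % p) (Nat.mod_lt _ hppos) hrsp).imp ?_ ?_ <;>
      · intro h i hi j hj hir hjs
        exact h i (by omega) j (by omega) (hmod i r hir) (hmod j s hjs)

/-- If the orbit converges along an arithmetic progression, its ω-limit set is finite. -/
lemma finite_omegaLimit_of_tendsto (hF : Continuous F) (hx : ∀ m k, x (k + m) = F^[m] (x k))
    {p i : ℕ} (hp : p ≠ 0) {l : ℝ} (hl : Tendsto (fun k => x (p * k + i)) atTop (nhds l)) :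
    (⋂ n : ℕ, closure (x '' Set.Ici n)).Finite := by
  refine ((Finset.range p).finite_toSet.image fun j => F^[j] l).subset fun y hy => ?_
  set S := (fun j => F^[j] l) '' (Finset.range p : Set ℕ) with hS
  have hSc : IsClosed S := ((Finset.range p).finite_toSet.image _).isClosed
  by_contra hyS
  obtain ⟨ε, hε, hball⟩ := Metric.isOpen_iff.1 hSc.isOpen_compl y hyS
  have hev : ∀ᶠ k in atTop, ∀ j ∈ Finset.range p, dist (x (p * k + i + j)) (F^[j] l) < ε / 2 := by
    refine (Filter.eventually_all_finset _).2 fun j _ => ?_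
    have := ((hF.iterate j).tendsto l).comp hl
    refine (Metric.tendsto_nhds.1 this (ε / 2) (half_pos hε)).mono fun k hk => ?_
    rwa [hx]
  obtain ⟨k₀, hk₀⟩ := eventually_atTop.1 hev
  obtain ⟨_, ⟨m, hm, rfl⟩, hmy⟩ :=
    Metric.mem_closure_iff.1 (Set.mem_iInter.1 hy (p * k₀ + i)) (ε / 2) (half_pos hε)
  have hm : p * k₀ + i ≤ m := hm
  have hlt := Nat.mod_lt (m - i) (Nat.pos_of_ne_zero hp)
  have hk : k₀ ≤ (m - i) / p := by
    rw [Nat.le_div_iff_mul_le (Nat.pos_of_ne_zero hp), mul_comm]; omega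
  have h := hk₀ _ hk _ (Finset.mem_range.2 hlt)
  have hme : p * ((m - i) / p) + i + (m - i) % p = m := by
    have := Nat.div_add_mod (m - i) p
    omega
  rw [hme] at h
  refine hball (?_ : F^[(m - i) % p] l ∈ Metric.ball y ε) ⟨_, by simpa using hlt, rfl⟩
  rw [Metric.mem_ball, dist_comm]
  linarith [dist_triangle y (x m) (F^[(m - i) % p] l)]

end Orbit

lemma sum_sub_le_of_pairwise_ordered {ι : Type*} (s : Finset ι) {lo hi : ι → ℝ} {a b : ℝ}
    (hle : ∀ i ∈ s, lo i ≤ hi i) (ha : ∀ i ∈ s, a ≤ lo i) (hb : ∀ i ∈ s, hi i ≤ b)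
    (hab : a ≤ b) (hord : ∀ i ∈ s, ∀ j ∈ s, i ≠ j → hi i ≤ lo j ∨ hi j ≤ lo i) :
    ∑ i ∈ s, (hi i - lo i) ≤ b - a := by
  have hdisj : (s : Set ι).PairwiseDisjoint fun i => Set.Ioo (lo i) (hi i) := by
    intro i hi' j hj hij
    rw [Function.onFun, Set.disjoint_left]
    rintro t ⟨h1, h2⟩ ⟨h3, h4⟩
    rcases hord i hi' j hj hij with h | h <;> linarith
  have hvol := MeasureTheory.measure_biUnion_finset (μ := MeasureTheory.volume) hdisj
    fun i _ => measurableSet_Ioo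
  have hsub : (⋃ i ∈ s, Set.Ioo (lo i) (hi i)) ⊆ Set.Icc a b :=
    Set.iUnion₂_subset fun i hi' t ht => ⟨(ha i hi').trans ht.1.le, ht.2.le.trans (hb i hi')⟩
  have := MeasureTheory.measure_mono (μ := MeasureTheory.volume) hsub
  rw [hvol, Real.volume_Icc] at this
  simp only [Real.volume_Ioo] at this
  rw [← ENNReal.ofReal_sum_of_nonneg fun i hi' => sub_nonneg.2 (hle i hi')] at this
  exact (ENNReal.ofReal_le_ofReal_iff (sub_nonneg.2 hab)).1 this

lemma sum_range_mul_mod (g : ℕ → ℝ) (p q : ℕ) :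
    ∑ m ∈ Finset.range (p * q), g (m % p) = q * ∑ r ∈ Finset.range p, g r := by
  induction q with
  | zero => simp
  | succ q ih =>
    rw [Nat.mul_succ, Finset.sum_range_add, ih]
    have : ∑ m ∈ Finset.range p, g ((p * q + m) % p) = ∑ r ∈ Finset.range p, g r :=
      Finset.sum_congr rfl fun m hm => by
        rw [Nat.mul_add_mod, Nat.mod_eq_of_lt (Finset.mem_range.1 hm)]
    rw [this]
    push_cast
    ring

/-- Cesàro means of a sequence eventually dominated by a `p`-periodic one are asymptotically
bounded by the mean over a period. -/
lemma limsup_average_le_of_le_periodic {u g : ℕ → ℝ} {p N : ℕ} {C : ℝ} (hp : 0 < p)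
    (hu : ∀ n, 0 ≤ u n) (huC : ∀ n, u n ≤ C) (hg : ∀ r, 0 ≤ g r)
    (hug : ∀ n ≥ N, u n ≤ g (n % p)) :
    limsup (fun M : ℕ => (∑ n ∈ Finset.Icc 1 M, u n) / M) atTop ≤
      (∑ r ∈ Finset.range p, g r) / p := by
  set A := ∑ r ∈ Finset.range p, g r with hA
  have hC : 0 ≤ C := (hu 0).trans (huC 0)
  have hA0 : 0 ≤ A := Finset.sum_nonneg fun r _ => hg r
  have hsum : ∀ M : ℕ, ∑ n ∈ Finset.Icc 1 M, u n ≤ N * C + ((M / p : ℕ) + 1) * A := by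
    intro M
    calc ∑ n ∈ Finset.Icc 1 M, u n
        ≤ ∑ n ∈ Finset.Icc 1 M, ((if n < N then C else 0) + g (n % p)) := by
          refine Finset.sum_le_sum fun n _ => ?_
          split_ifs with h
          · linarith [huC n, hg (n % p)]
          · linarith [hug n (not_lt.1 h)]
      _ = ∑ n ∈ Finset.Icc 1 M, (if n < N then C else 0) + ∑ n ∈ Finset.Icc 1 M, g (n % p) :=
          Finset.sum_add_distrib
      _ ≤ N * C + ((M / p : ℕ) + 1) * A := by
          refine add_le_add ?_ ?_
          · rw [← Finset.sum_filter, Finset.sum_const, nsmul_eq_mul]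
            refine mul_le_mul_of_nonneg_right ?_ hC
            have : (Finset.Icc 1 M).filter (· < N) ⊆ Finset.range N := fun n hn =>
              Finset.mem_range.2 (Finset.mem_filter.1 hn).2
            exact_mod_cast (Finset.card_le_card this).trans_eq (Finset.card_range N)
          · have hsub : Finset.Icc 1 M ⊆ Finset.range (p * (M / p + 1)) := fun n hn =>
              Finset.mem_range.2 ((Finset.mem_Icc.1 hn).2.trans_lt (Nat.lt_mul_div_succ M hp))
            refine (Finset.sum_le_sum_of_subset_of_nonneg hsub fun n _ _ => hg _).trans ?_
            rw [sum_range_mul_mod]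
            push_cast
            exact le_rfl
  have hbound : ∀ᶠ M : ℕ in atTop,
      (∑ n ∈ Finset.Icc 1 M, u n) / M ≤ (N * C + A) / M + A / p := by
    filter_upwards [eventually_gt_atTop 0] with M hM
    have hM' : (0 : ℝ) < M := by exact_mod_cast hM
    have hp' : (0 : ℝ) < p := by exact_mod_cast hp
    rw [div_le_iff₀ hM', add_mul, div_mul_cancel₀ _ hM'.ne']
    have h1 : ((M / p : ℕ) : ℝ) ≤ M / p := Nat.cast_div_le
    have h2 := mul_le_mul_of_nonneg_right h1 hA0
    have h3 : A / p * M = M / p * A := by ring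
    linarith [hsum M]
  have hlim : Tendsto (fun M : ℕ => (N * C + A) / (M : ℝ) + A / p) atTop (nhds (A / p)) := by
    simpa using (tendsto_const_div_atTop_nhds_zero_nat (N * C + A)).add_const (A / p)
  rw [← hlim.limsup_eq]
  refine limsup_le_limsup hbound ?_ hlim.isBoundedUnder_le
  exact isCoboundedUnder_le_of_le atTop (x := 0) fun M =>
    div_nonneg (Finset.sum_nonneg fun n _ => hu n) (Nat.cast_nonneg M)

/-- Suppose `f` is a continuous interval map with zero topological entropy and `x` has
infinite ω-limit set `K = ω(x)`. Then `x` is mean-attracted to `K`: for every `ε > 0`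
there is `z ∈ K` with `limsup_{N→∞} (1/N) Σ_{n=1}^{N} |fⁿx − fⁿz| < ε`. -/
theorem infinite_omega_limit_mean_attracted (a b : ℝ) (f : ℝ → ℝ)
    (hf : ContinuousOn f (Set.Icc a b))
    (hmaps : Set.MapsTo f (Set.Icc a b) (Set.Icc a b))
    (hent : coverEntropy f (Set.Icc a b) = 0)
    (x : ℝ) (hx : x ∈ Set.Icc a b)
    (K : Set ℝ)
    (hK : K = ⋂ n : ℕ, closure ((fun k : ℕ => f^[k] x) '' Set.Ici n))
    (hKinf : K.Infinite) :
    ∀ ε > (0 : ℝ), ∃ z ∈ K,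
      limsup (fun N : ℕ => (∑ n ∈ Finset.Icc 1 N, |f^[n] x - f^[n] z|) / N) atTop < ε := by
  intro ε hε
  have hab : a ≤ b := hx.1.trans hx.2
  let F : ℝ → ℝ := Set.IccExtend hab ((Set.Icc a b).domRestrict f)
  have hF : Continuous F := (continuousOn_iff_continuous_domRestrict.1 hf).Icc_extend'
  have hFf : ∀ t ∈ Set.Icc a b, F t = f t := fun t ht => by
    simp [F, Set.IccExtend_of_mem hab _ ht, Set.domRestrict]
  have hFmaps : ∀ t, F t ∈ Set.Icc a b := fun t => hmaps (Set.projIcc a b hab t).2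
  have hfree : ∀ k ≠ 0, FoldFree F^[k] := fun k hk =>
    foldFree_iterate hF hFmaps (fun t ht => (hFf t ht).symm) hent hk
  have hiter : ∀ n, ∀ t ∈ Set.Icc a b, f^[n] t = F^[n] t := by
    intro n
    induction n with
    | zero => intro t _; rfl
    | succ n ih =>
      intro t ht
      rw [Function.iterate_succ_apply, Function.iterate_succ_apply, hFf t ht]
      exact ih _ (hmaps ht)
  have horbit : ∀ n, ∀ t ∈ Set.Icc a b, f^[n] t ∈ Set.Icc a b := fun n t ht =>
    hmaps.iterate n ht
  set y : ℕ → ℝ := fun k => f^[k] x with hy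
  have hyab : ∀ n, y n ∈ Set.Icc a b := fun n => horbit n x hx
  have hyadd : ∀ m k, y (k + m) = F^[m] (y k) := fun m k => by
    rw [← hiter m _ (hyab k), hy]
    simp only
    rw [add_comm, Function.iterate_add_apply]
  have hconv : ∀ p ≠ 0, ∀ i, ¬ ∃ l, Tendsto (fun k => y (p * k + i)) atTop (nhds l) := by
    rintro p hp i ⟨l, hl⟩
    exact hKinf (hK ▸ finite_omegaLimit_of_tendsto hF hyadd hp hl)
  obtain ⟨n, hn⟩ : ∃ n : ℕ, (b - a) / 2 ^ n < ε := by
    obtain ⟨n, hn⟩ := pow_unbounded_of_one_lt ((b - a) / ε) (one_lt_two (α := ℝ))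
    exact ⟨n, by rw [div_lt_iff₀ (by positivity)]; rwa [div_lt_iff₀' hε] at hn⟩
  obtain ⟨N, hN⟩ := exists_residue_tails_ordered hF hfree (fun k => hyadd 1 k) hyab hconv n
  have hp : 0 < 2 ^ n := by positivity
  rw [← Nat.cast_ofNat, ← Nat.cast_pow] at hn
  generalize 2 ^ n = p at hn hN hp
  let T : ℕ → Set ℝ := fun r => {t | ∃ k ≥ N, k % p = r ∧ t = y k}
  have hTne : ∀ r < p, (T r).Nonempty := fun r hr =>
    ⟨_, p * N + r, by nlinarith, by rw [Nat.mul_add_mod, Nat.mod_eq_of_lt hr], rfl⟩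
  have hTsub : ∀ r, T r ⊆ Set.Icc a b := by
    rintro r _ ⟨k, -, -, rfl⟩
    exact hyab k
  have hTb : ∀ r, BddBelow (T r) := fun r => bddBelow_Icc.mono (hTsub r)
  have hTa : ∀ r, BddAbove (T r) := fun r => bddAbove_Icc.mono (hTsub r)
  have hlen : ∀ r < p, sInf (T r) ≤ sSup (T r) := fun r hr =>
    csInf_le_csSup (hTne r hr) (hTb r) (hTa r)
  have hsum : ∑ r ∈ Finset.range p, (sSup (T r) - sInf (T r)) ≤ b - a := by
    refine sum_sub_le_of_pairwise_ordered _ (fun r hr => hlen r (Finset.mem_range.1 hr))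
      (fun r hr => le_csInf (hTne r (Finset.mem_range.1 hr)) fun t ht => (hTsub r ht).1)
      (fun r hr => csSup_le (hTne r (Finset.mem_range.1 hr)) fun t ht => (hTsub r ht).2) hab ?_
    intro r hr s hs hrs
    rw [Finset.mem_range] at hr hs
    refine (hN r hr s hs hrs).imp (fun h => ?_) (fun h => ?_)
    · refine csSup_le (hTne r hr) ?_
      rintro _ ⟨i, hi, hir, rfl⟩
      refine le_csInf (hTne s hs) ?_
      rintro _ ⟨j, hj, hjs, rfl⟩
      exact h i hi j hj hir hjs
    · refine csSup_le (hTne s hs) ?_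
      rintro _ ⟨j, hj, hjs, rfl⟩
      refine le_csInf (hTne r hr) ?_
      rintro _ ⟨i, hi, hir, rfl⟩
      exact h i hi j hj hir hjs
  obtain ⟨z, hz, φ, hφ, hlim⟩ := isCompact_Icc.tendsto_subseq fun k => hyab (p * k)
  have hlim : Tendsto (fun k => y (p * φ k)) atTop (nhds z) := hlim
  have hlarge : Tendsto (fun k => p * φ k) atTop atTop :=
    tendsto_atTop_mono (fun k => (hφ.le_apply).trans (Nat.le_mul_of_pos_left _ hp)) tendsto_id
  have hmem : ∀ m, f^[m] z ∈ Set.Icc (sInf (T (m % p))) (sSup (T (m % p))) := by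
    intro m
    have hlimm : Tendsto (fun k => y (p * φ k + m)) atTop (nhds (f^[m] z)) := by
      simp only [hyadd]
      rw [hiter m z hz]
      exact ((hF.iterate m).tendsto z).comp hlim
    refine isClosed_Icc.mem_of_tendsto hlimm ?_
    filter_upwards [hlarge.eventually_ge_atTop N] with k hk
    have : y (p * φ k + m) ∈ T (m % p) := ⟨_, by omega, by rw [Nat.mul_add_mod], rfl⟩
    exact ⟨csInf_le (hTb _) this, le_csSup (hTa _) this⟩
  refine ⟨z, ?_, ?_⟩
  · rw [hK, Set.mem_iInter]
    intro k
    refine mem_closure_of_tendsto hlim ?_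
    filter_upwards [hlarge.eventually_ge_atTop k] with j hj
    exact ⟨_, hj, rfl⟩
  · have hdist : ∀ u v c d : ℝ, u ∈ Set.Icc c d → v ∈ Set.Icc c d → |u - v| ≤ d - c := by
      intro u v c d hu hv
      rw [abs_le]
      constructor <;> linarith [hu.1, hu.2, hv.1, hv.2]
    refine lt_of_le_of_lt (limsup_average_le_of_le_periodic (N := N) (C := b - a)
      (g := fun r => |sSup (T r) - sInf (T r)|) hp (fun _ => abs_nonneg _)
      (fun m => hdist _ _ _ _ (hyab m) (horbit m z hz)) (fun _ => abs_nonneg _) ?_)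
      (lt_of_le_of_lt ?_ hn)
    · intro m hm
      have : y m ∈ T (m % p) := ⟨m, hm, rfl, rfl⟩
      exact (hdist _ _ _ _ ⟨csInf_le (hTb _) this, le_csSup (hTa _) this⟩ (hmem m)).trans
        (le_abs_self _)
    · refine div_le_div_of_nonneg_right ?_ (Nat.cast_nonneg p)
      rw [Finset.sum_congr rfl fun r hr =>
        abs_of_nonneg (sub_nonneg.2 (hlen r (Finset.mem_range.1 hr)))]
      exact hsum
end

section
/- Suppose f is a continuous interval map with zero topological entropy and K ⊆ I is a minimal set for f. Then the sub-flow (K, f|K) is mean-L-stable: for every ε > 0 there is δ > 0 such that for u, v ∈ K with |u − v| < δ, |fⁿu − fⁿv| < ε holds for all n ∈ ℕ outside a set E ⊂ ℕ with upper density less than ε. -/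
open Filter Dynamics

open Classical in
/-- The upper density of a set `E ⊆ ℕ`: `limsup_{N→∞} #(E ∩ [1,N]) / N`. -/
noncomputable def upperDensity (E : Set ℕ) : ℝ :=
  limsup (fun N : ℕ => (∑ n ∈ Finset.Icc 1 N, if n ∈ E then (1 : ℝ) else 0) / N) atTop

/-- If disjoint, uniformly separated sets `A` and `B` are both covered by the `n`-th iterate image
of each of them, there are arbitrarily large separated sets of points following itineraries
in `A ∪ B`. -/
theorem exists_separated_finset_of_covering {X : Type*} [PseudoMetricSpace X] {g : X → X}
    {A B : Set X} {η : ℝ} (hη : 0 < η) (hne : (A ∪ B).Nonempty)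
    (hsep : ∀ x ∈ A, ∀ y ∈ B, η ≤ dist x y)
    (hA : A ∪ B ⊆ g '' A) (hB : A ∪ B ⊆ g '' B) (m : ℕ) :
    ∃ S : Finset X, (S : Set X) ⊆ A ∪ B ∧ S.card = 2 ^ m ∧
      ∀ x ∈ S, ∀ y ∈ S, x ≠ y → ∃ i < m, η ≤ dist (g^[i] x) (g^[i] y) := by
  classical
  choose! φ hφA hφ using hA
  choose! ψ hψB hψ using hB
  have hdisj : ∀ x ∈ A, x ∉ B := fun x hxA hxB => by
    have := hsep x hxA x hxB
    rw [dist_self] at this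
    linarith
  induction m with
  | zero =>
    obtain ⟨x, hx⟩ := hne
    exact ⟨{x}, by simpa using hx, by simp, by simp⟩
  | succ m ih =>
    obtain ⟨S, hS, hcard, hsepS⟩ := ih
    have hφinj : Set.InjOn φ S := fun x hx y hy h => by
      rw [← hφ (hS hx), ← hφ (hS hy), h]
    have hψinj : Set.InjOn ψ S := fun x hx y hy h => by
      rw [← hψ (hS hx), ← hψ (hS hy), h]
    refine ⟨S.image φ ∪ S.image ψ, ?_, ?_, ?_⟩
    · intro x hx
      simp only [Finset.coe_union, Finset.coe_image, Set.mem_union, Set.mem_image,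
        Finset.mem_coe] at hx
      rcases hx with ⟨y, hy, rfl⟩ | ⟨y, hy, rfl⟩
      · exact Or.inl (hφA (hS hy))
      · exact Or.inr (hψB (hS hy))
    · rw [Finset.card_union_of_disjoint, Finset.card_image_of_injOn hφinj,
        Finset.card_image_of_injOn hψinj, hcard, pow_succ]
      · ring
      · rw [Finset.disjoint_left]
        intro x hx hx'
        obtain ⟨y, hy, rfl⟩ := Finset.mem_image.1 hx
        obtain ⟨z, hz, hzy⟩ := Finset.mem_image.1 hx'
        exact hdisj _ (hφA (hS hy)) (hzy ▸ hψB (hS hz))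
    · intro x hx y hy hxy
      rw [Finset.mem_union, Finset.mem_image, Finset.mem_image] at hx hy
      rcases hx with ⟨x', hx', rfl⟩ | ⟨x', hx', rfl⟩ <;>
        rcases hy with ⟨y', hy', rfl⟩ | ⟨y', hy', rfl⟩
      · obtain ⟨i, hi, h⟩ := hsepS x' hx' y' hy' fun h => hxy (by rw [h])
        refine ⟨i + 1, by lia, ?_⟩
        simpa only [Function.iterate_succ_apply, hφ (hS hx'), hφ (hS hy')] using h
      · exact ⟨0, by lia, hsep _ (hφA (hS hx')) _ (hψB (hS hy'))⟩
      · refine ⟨0, by lia, ?_⟩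
        rw [dist_comm]
        exact hsep _ (hφA (hS hy')) _ (hψB (hS hx'))
      · obtain ⟨i, hi, h⟩ := hsepS x' hx' y' hy' fun h => hxy (by rw [h])
        refine ⟨i + 1, by lia, ?_⟩
        simpa only [Function.iterate_succ_apply, hψ (hS hx'), hψ (hS hy')] using h

/-- A horseshoe for some iterate forces positive topological entropy. -/
theorem coverEntropy_ne_zero_of_covering {X : Type*} [PseudoMetricSpace X] {T : X → X}
    {F A B : Set X} {η : ℝ} {n : ℕ} (hn : n ≠ 0) (hη : 0 < η) (hne : (A ∪ B).Nonempty)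
    (hF : A ∪ B ⊆ F) (hsep : ∀ x ∈ A, ∀ y ∈ B, η ≤ dist x y)
    (hA : A ∪ B ⊆ T^[n] '' A) (hB : A ∪ B ⊆ T^[n] '' B) :
    coverEntropy T F ≠ 0 := by
  set U : SetRel X X := {q | dist q.1 q.2 < η / 2} with hU
  have hUu : U ∈ uniformity X := Metric.dist_mem_uniformity (half_pos hη)
  have hnet : ∀ m : ℕ, (2 : ENNReal) ^ m ≤ (netMaxcard T F U (n * m) : ENat) := by
    intro m
    obtain ⟨S, hS, hcard, hsepS⟩ := exists_separated_finset_of_covering hη hne hsep hA hB m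
    have hSnet : IsDynNetIn T F U (n * m) S := by
      refine ⟨hS.trans hF, fun x hx y hy hxy => ?_⟩
      obtain ⟨i, hi, h⟩ := hsepS x hx y hy hxy
      rw [Function.onFun, Set.disjoint_left]
      intro z hzx hzy
      have hlt : n * i < n * m := Nat.mul_lt_mul_of_pos_left hi (Nat.pos_of_ne_zero hn)
      have h1 : dist (T^[n * i] x) (T^[n * i] z) < η / 2 := mem_ball_dynEntourage.1 hzx _ hlt
      have h2 : dist (T^[n * i] y) (T^[n * i] z) < η / 2 := mem_ball_dynEntourage.1 hzy _ hlt
      rw [← Function.iterate_mul] at h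
      have h3 := dist_triangle_right (T^[n * i] x) (T^[n * i] y) (T^[n * i] z)
      linarith
    have h := ENat.toENNReal_mono hSnet.card_le_netMaxcard
    rw [hcard] at h
    simpa using h
  have hgrow : ENNReal.log 2 ≤ n * netEntropyEntourage T F U := by
    have hmono : Monotone fun k : ℕ => ((netMaxcard T F U k : ENat) : ENNReal) :=
      fun _ _ h => ENat.toENNReal_mono (netMaxcard_monotone_time T F U h)
    rw [netEntropyEntourage, ← hmono.expGrowthSup_comp_mul hn, ← ExpGrowth.expGrowthSup_pow]
    exact ExpGrowth.expGrowthSup_monotone hnet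
  intro h0
  have hle : netEntropyEntourage T F U ≤ 0 := h0 ▸ netEntropyEntourage_le_coverEntropy T F hUu
  have h1 : (n : EReal) * netEntropyEntourage T F U ≤ 0 :=
    mul_nonpos_of_nonneg_of_nonpos (by positivity) hle
  have h2 : (0 : EReal) < ENNReal.log 2 := by
    rw [ENNReal.zero_lt_log_iff]
    norm_num
  exact absurd (hgrow.trans h1) (not_le.2 h2)

/-- Some iterate of `f` has two intervals in `[a, b]`, sharing an endpoint fixed by the iterate,
each of which it stretches over their union. -/
def HasIterateHorseshoe (f : ℝ → ℝ) (a b : ℝ) : Prop :=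
  ∃ (n : ℕ) (d p u : ℝ), a ≤ d ∧ d < p ∧ p < u ∧ u ≤ b ∧ f^[n] p = p ∧
    Set.Icc d u ⊆ f^[n] '' Set.Icc d p ∧ Set.Icc d u ⊆ f^[n] '' Set.Icc p u

theorem HasIterateHorseshoe.of_iterate {f : ℝ → ℝ} {a b : ℝ} {m : ℕ}
    (h : HasIterateHorseshoe f^[m] a b) : HasIterateHorseshoe f a b := by
  obtain ⟨n, h⟩ := h
  rw [← Function.iterate_mul] at h
  exact ⟨m * n, h⟩

theorem not_hasIterateHorseshoe_of_coverEntropy_eq_zero {a b : ℝ} {f : ℝ → ℝ}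
    (hf : ContinuousOn f (Set.Icc a b)) (hmaps : Set.MapsTo f (Set.Icc a b) (Set.Icc a b))
    (hent : coverEntropy f (Set.Icc a b) = 0) : ¬ HasIterateHorseshoe f a b := by
  rintro ⟨n, d, p, u, had, hdp, hpu, hub, hp, hL, hR⟩
  have hn : n ≠ 0 := by
    rintro rfl
    rw [Function.iterate_zero, Set.image_id] at hL
    exact absurd (hL ⟨(hdp.trans hpu).le, le_rfl⟩).2 (not_le.2 hpu)
  obtain ⟨x, hx, hxd⟩ := hR ⟨le_rfl, (hdp.trans hpu).le⟩
  obtain ⟨y, hy, hyu⟩ := hR ⟨(hdp.trans hpu).le, le_rfl⟩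
  have hpx : p < x := lt_of_le_of_ne hx.1 fun h => by rw [← h, hp] at hxd; exact hdp.ne' hxd
  have hpy : p < y := lt_of_le_of_ne hy.1 fun h => by rw [← h, hp] at hyu; exact hpu.ne hyu
  have hxy : Set.uIcc x y ⊆ Set.Icc p u := Set.uIcc_subset_Icc hx hy
  have hsub : Set.Icc d p ∪ Set.uIcc x y ⊆ Set.Icc d u :=
    Set.union_subset (Set.Icc_subset_Icc_right hpu.le)
      (hxy.trans (Set.Icc_subset_Icc_left hdp.le))
  have hcont : ContinuousOn f^[n] (Set.uIcc x y) :=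
    (hf.iterate hmaps n).mono fun z hz =>
      ⟨(had.trans hdp.le).trans (hxy hz).1, (hxy hz).2.trans hub⟩
  have hcov : Set.Icc d u ⊆ f^[n] '' Set.uIcc x y := by
    have := intermediate_value_uIcc hcont
    rwa [hxd, hyu, Set.uIcc_of_le (hdp.trans hpu).le] at this
  refine coverEntropy_ne_zero_of_covering hn (sub_pos.2 (lt_min hpx hpy))
    (Set.nonempty_Icc.2 hdp.le).inl (hsub.trans (Set.Icc_subset_Icc had hub)) ?_
    (hsub.trans hL) (hsub.trans hcov) hent
  intro s hs t ht
  rw [dist_comm, Real.dist_eq]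
  have h1 : min x y ≤ t := ht.1
  have h2 := hs.2
  exact le_trans (by linarith) (le_abs_self _)

theorem subset_iterate_image_of_subset_image {X : Type*} {f : X → X} {J : Set X}
    (h : J ⊆ f '' J) (n : ℕ) : J ⊆ f^[n] '' J := by
  induction n with
  | zero => simp
  | succ n ih =>
    rw [Function.iterate_succ', Set.image_comp]
    exact h.trans (Set.image_mono ih)

theorem uIcc_subset_iterate_image {a b p x : ℝ} {f : ℝ → ℝ}
    (hf : ContinuousOn f (Set.Icc a b)) (hmaps : Set.MapsTo f (Set.Icc a b) (Set.Icc a b))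
    (hpI : p ∈ Set.Icc a b) (hxI : x ∈ Set.Icc a b) (hp : f p = p) (n : ℕ) :
    Set.uIcc p (f^[n] x) ⊆ f^[n] '' Set.uIcc p x := by
  have h := intermediate_value_uIcc
    ((hf.iterate hmaps n).mono (Set.uIcc_subset_Icc hpI hxI))
  rwa [Function.iterate_fixed hp] at h

theorem exists_fixed_mem_Ioo {a b x y : ℝ} {f : ℝ → ℝ} (hf : ContinuousOn f (Set.Icc a b))
    (hxI : x ∈ Set.Icc a b) (hyI : y ∈ Set.Icc a b) (hxy : x < y)
    (h : (f x < x ∧ y < f y) ∨ (x < f x ∧ f y < y)) : ∃ p ∈ Set.Ioo x y, f p = p := by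
  have hc : ContinuousOn (fun t => f t - t) (Set.Icc x y) :=
    (hf.mono (Set.Icc_subset_Icc hxI.1 hyI.2)).sub continuousOn_id
  rcases h with ⟨h1, h2⟩ | ⟨h1, h2⟩
  · obtain ⟨p, hp, hp0⟩ := intermediate_value_Ioo hxy.le hc
      (show (0 : ℝ) ∈ Set.Ioo (f x - x) (f y - y) from ⟨by linarith, by linarith⟩)
    exact ⟨p, hp, sub_eq_zero.1 hp0⟩
  · obtain ⟨p, hp, hp0⟩ := intermediate_value_Ioo' hxy.le hc
      (show (0 : ℝ) ∈ Set.Ioo (f y - y) (f x - x) from ⟨by linarith, by linarith⟩)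
    exact ⟨p, hp, sub_eq_zero.1 hp0⟩

section Minimal

variable {a b : ℝ} {f : ℝ → ℝ} {K : Set ℝ}

/-- In a minimal set of a map without horseshoes, points moving up lie to the left of points
moving down. -/
theorem lt_of_lt_map_of_map_lt (hf : ContinuousOn f (Set.Icc a b))
    (hmaps : Set.MapsTo f (Set.Icc a b) (Set.Icc a b)) (hhs : ¬ HasIterateHorseshoe f a b)
    (hK : K ⊆ Set.Icc a b) (hKinv : Set.MapsTo f K K)
    (hmin : ∀ x ∈ K, K ⊆ closure (Set.range fun n : ℕ => f^[n] x))
    {u d : ℝ} (huK : u ∈ K) (hdK : d ∈ K) (hu : u < f u) (hd : f d < d) : u < d := by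
  by_contra! hdu
  have hdu : d < u := lt_of_le_of_ne hdu fun h => by rw [h] at hd; exact lt_asymm hd hu
  obtain ⟨p, ⟨hdp, hpu⟩, hp⟩ := exists_fixed_mem_Ioo hf (hK hdK) (hK huK) hdu (Or.inl ⟨hd, hu⟩)
  have hpI : p ∈ Set.Icc a b := ⟨(hK hdK).1.trans hdp.le, hpu.le.trans (hK huK).2⟩
  have hcovu := uIcc_subset_iterate_image hf hmaps hpI (hK huK) hp
  have hcovd := uIcc_subset_iterate_image hf hmaps hpI (hK hdK) hp
  rw [Set.uIcc_of_le hpu.le] at hcovu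
  rw [Set.uIcc_of_ge hdp.le] at hcovd
  have hJu : Set.Icc p u ⊆ f '' Set.Icc p u :=
    (Set.Icc_subset_uIcc.trans' (Set.Icc_subset_Icc_right hu.le)).trans (hcovu 1)
  have hJd : Set.Icc d p ⊆ f '' Set.Icc d p :=
    (Set.Icc_subset_uIcc'.trans' (Set.Icc_subset_Icc_left hd.le)).trans (hcovd 1)
  obtain ⟨_, hm, m, rfl⟩ := mem_closure_iff.1 (hmin u huK (hKinv hdK)) (Set.Iio d) isOpen_Iio hd
  obtain ⟨_, hm', m', rfl⟩ :=
    mem_closure_iff.1 (hmin d hdK (hKinv huK)) (Set.Ioi u) isOpen_Ioi hu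
  simp only [Set.mem_Iio, Set.mem_Ioi] at hm hm'
  have hbigu : Set.Icc d u ⊆ f^[m] '' Set.Icc p u := by
    rw [← Set.Icc_union_Icc_eq_Icc hdp.le hpu.le]
    exact Set.union_subset
      ((Set.Icc_subset_uIcc'.trans' (Set.Icc_subset_Icc_left hm.le)).trans (hcovu m))
      (subset_iterate_image_of_subset_image hJu m)
  have hbigd : Set.Icc d u ⊆ f^[m'] '' Set.Icc d p := by
    rw [← Set.Icc_union_Icc_eq_Icc hdp.le hpu.le]
    exact Set.union_subset (subset_iterate_image_of_subset_image hJd m')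
      ((Set.Icc_subset_uIcc.trans' (Set.Icc_subset_Icc_right hm'.le)).trans (hcovd m'))
  refine hhs ⟨m + m', d, p, u, (hK hdK).1, hdp, hpu, (hK huK).2, Function.iterate_fixed hp _,
    ?_, ?_⟩
  · rw [add_comm, Function.iterate_add, Set.image_comp]
    exact hbigd.trans (Set.image_mono (subset_iterate_image_of_subset_image hJd m))
  · rw [Function.iterate_add, Set.image_comp]
    exact hbigu.trans (Set.image_mono (subset_iterate_image_of_subset_image hJu m'))

/-- If `f` maps the two ends `l < r` of a gap across a fixed point `p` of the gap, and `f` has no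
iterated horseshoe, then the orbit of `l` cannot return to the wrong side of the gap. -/
theorem iterate_parity_of_not_hasIterateHorseshoe (hf : ContinuousOn f (Set.Icc a b))
    (hmaps : Set.MapsTo f (Set.Icc a b) (Set.Icc a b)) (hhs : ¬ HasIterateHorseshoe f a b)
    {l p r : ℝ} (hl : l ∈ Set.Icc a b) (hr : r ∈ Set.Icc a b) (hlp : l < p) (hpr : p < r)
    (hp : f p = p) (hfl : r ≤ f l) (hfr : f r ≤ l) (k : ℕ) :
    (Even k → f^[k] l < r) ∧ (Odd k → l < f^[k] l) := by
  have hpI : p ∈ Set.Icc a b := ⟨hl.1.trans hlp.le, hpr.le.trans hr.2⟩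
  have hcovl := uIcc_subset_iterate_image hf hmaps hpI hl hp
  have hcovr := uIcc_subset_iterate_image hf hmaps hpI hr hp
  rw [Set.uIcc_of_ge hlp.le] at hcovl
  rw [Set.uIcc_of_le hpr.le] at hcovr
  have hLR : Set.Icc p r ⊆ f '' Set.Icc l p :=
    (Set.Icc_subset_uIcc.trans' (Set.Icc_subset_Icc_right hfl)).trans (hcovl 1)
  have hRL : Set.Icc l p ⊆ f '' Set.Icc p r :=
    (Set.Icc_subset_uIcc'.trans' (Set.Icc_subset_Icc_left hfr)).trans (hcovr 1)
  have hunion := Set.Icc_union_Icc_eq_Icc hlp.le hpr.le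
  have heven : ∀ j, Set.Icc l p ⊆ f^[2 * j] '' Set.Icc l p := fun j => by
    rw [Function.iterate_mul]
    refine subset_iterate_image_of_subset_image ?_ j
    rw [Function.iterate_succ', Function.iterate_one, Set.image_comp]
    exact hRL.trans (Set.image_mono hLR)
  have hodd : ∀ j, Set.Icc p r ⊆ f^[2 * j + 1] '' Set.Icc l p := fun j => by
    rw [Function.iterate_succ', Set.image_comp]
    exact hLR.trans (Set.image_mono (heven j))
  have hcontra : ¬ Set.Icc l r ⊆ f^[k] '' Set.Icc l p := fun hcov => by
    refine hhs ⟨k + 1, l, p, r, hl.1, hlp, hpr, hr.2, Function.iterate_fixed hp _, ?_, ?_⟩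
    · rw [Function.iterate_succ', Set.image_comp]
      refine Set.Subset.trans ?_ (Set.image_mono hcov)
      rw [← hunion, Set.image_union, Set.union_comm]
      exact Set.union_subset_union hLR hRL
    · rw [Function.iterate_succ, Set.image_comp]
      exact hcov.trans (Set.image_mono hRL)
  constructor
  · intro hk
    by_contra! h
    apply hcontra
    rw [← hunion]
    refine Set.union_subset ?_
      ((Set.Icc_subset_uIcc.trans' (Set.Icc_subset_Icc_right h)).trans (hcovl k))
    obtain ⟨j, rfl⟩ := hk.two_dvd
    exact heven j
  · intro hk
    by_contra! h
    apply hcontra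
    rw [← hunion]
    refine Set.union_subset
      ((Set.Icc_subset_uIcc'.trans' (Set.Icc_subset_Icc_left h)).trans (hcovl k)) ?_
    obtain ⟨j, rfl⟩ := hk
    exact hodd j

/-- A nontrivial minimal set of an interval map without horseshoes splits into a left and a right
half which are interchanged by the map. -/
theorem exists_swapped_halves (hf : ContinuousOn f (Set.Icc a b))
    (hmaps : Set.MapsTo f (Set.Icc a b) (Set.Icc a b)) (hhs : ¬ HasIterateHorseshoe f a b)
    (hK : K ⊆ Set.Icc a b) (hKcl : IsClosed K) (hKinv : Set.MapsTo f K K)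
    (hmin : ∀ x ∈ K, K ⊆ closure (Set.range fun n : ℕ => f^[n] x)) (hnt : K.Nontrivial) :
    ∃ l r, l < r ∧ ∀ x ∈ K, (x ≤ l ∧ r ≤ f x) ∨ (r ≤ x ∧ f x ≤ l) := by
  have hKc : IsCompact K := isCompact_Icc.of_isClosed_subset hKcl hK
  have hfK : ContinuousOn f K := hf.mono hK
  have hnofix : ∀ x ∈ K, f x ≠ x := fun x hx h => by
    have h1 := hmin x hx
    simp only [Function.iterate_fixed h, Set.range_const, closure_singleton] at h1
    exact Set.not_subsingleton_iff.2 hnt (Set.subsingleton_singleton.anti h1)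
  have hUc : IsCompact (K ∩ {x | x ≤ f x}) :=
    hKc.of_isClosed_subset (hKcl.isClosed_le continuousOn_id hfK) Set.inter_subset_left
  have hDc : IsCompact (K ∩ {x | f x ≤ x}) :=
    hKc.of_isClosed_subset (hKcl.isClosed_le hfK continuousOn_id) Set.inter_subset_left
  obtain ⟨s, hs⟩ := hKc.exists_isLeast hnt.nonempty
  obtain ⟨t, ht⟩ := hKc.exists_isGreatest hnt.nonempty
  obtain ⟨l, ⟨hlK, hl⟩, hlmax⟩ := hUc.exists_isGreatest ⟨s, hs.1, hs.2 (hKinv hs.1)⟩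
  obtain ⟨r, ⟨hrK, hr⟩, hrmin⟩ := hDc.exists_isLeast ⟨t, ht.1, ht.2 (hKinv ht.1)⟩
  have hl : l < f l := lt_of_le_of_ne hl (hnofix l hlK).symm
  have hr : f r < r := lt_of_le_of_ne hr (hnofix r hrK)
  have hlr : l < r := lt_of_lt_map_of_map_lt hf hmaps hhs hK hKinv hmin hlK hrK hl hr
  have hside : ∀ x ∈ K, x ≤ l ∨ r ≤ x := fun x hx =>
    (le_total x (f x)).imp (fun h => hlmax ⟨hx, h⟩) (fun h => hrmin ⟨hx, h⟩)
  have hfl : r ≤ f l := (hside _ (hKinv hlK)).resolve_left (not_le.2 hl)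
  have hfr : f r ≤ l := (hside _ (hKinv hrK)).resolve_right (not_le.2 hr)
  obtain ⟨p, ⟨hlp, hpr⟩, hp⟩ :=
    exists_fixed_mem_Ioo hf (hK hlK) (hK hrK) hlr (Or.inr ⟨hl, hr⟩)
  have hpar := iterate_parity_of_not_hasIterateHorseshoe hf hmaps hhs (hK hlK) (hK hrK) hlp hpr
    hp hfl hfr
  have horb : ∀ k, f^[k] l ∈ K := fun k => hKinv.iterate k hlK
  have hswap : ∀ k, (f^[k] l ≤ l ∧ r ≤ f^[k + 1] l) ∨ (r ≤ f^[k] l ∧ f^[k + 1] l ≤ l) := by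
    intro k
    rcases Nat.even_or_odd k with hk | hk
    · exact Or.inl ⟨(hside _ (horb k)).resolve_right (not_le.2 ((hpar k).1 hk)),
        (hside _ (horb _)).resolve_left (not_le.2 ((hpar _).2 hk.add_one))⟩
    · exact Or.inr ⟨(hside _ (horb k)).resolve_left (not_le.2 ((hpar k).2 hk)),
        (hside _ (horb _)).resolve_right (not_le.2 ((hpar _).1 hk.add_one))⟩
  have hclosed : IsClosed ((K ∩ {x | x ≤ l} ∩ (K ∩ {x | r ≤ f x})) ∪
      (K ∩ {x | r ≤ x} ∩ (K ∩ {x | f x ≤ l}))) :=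
    ((hKcl.isClosed_le continuousOn_id continuousOn_const).inter
      (hKcl.isClosed_le continuousOn_const hfK)).union
    ((hKcl.isClosed_le continuousOn_const continuousOn_id).inter
      (hKcl.isClosed_le hfK continuousOn_const))
  refine ⟨l, r, hlr, fun x hx => ?_⟩
  have hmem := closure_minimal (t := _) (Set.range_subset_iff.2 fun k => ?_) hclosed
    (hmin l hlK hx)
  · exact hmem.imp (fun h => ⟨h.1.2, h.2.2⟩) (fun h => ⟨h.1.2, h.2.2⟩)
  · have := hswap k
    rw [Function.iterate_succ_apply'] at this
    exact this.imp (fun h => ⟨⟨horb k, h.1⟩, ⟨horb k, h.2⟩⟩)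
      (fun h => ⟨⟨horb k, h.1⟩, ⟨horb k, h.2⟩⟩)

/-- A relatively open piece of a minimal set which is left at odd times and revisited at even times
is minimal for the second iterate. -/
theorem subset_closure_range_iterate_two {X : Type*} [TopologicalSpace X] {f : X → X}
    {K V : Set X} (hV : IsOpen V) {x : X}
    (hmin : K ⊆ closure (Set.range fun n : ℕ => f^[n] x))
    (hodd : ∀ j, f^[2 * j + 1] x ∉ V) :
    K ∩ V ⊆ closure (Set.range fun n : ℕ => (f^[2])^[n] x) := by
  rintro y ⟨hyK, hyV⟩
  rw [mem_closure_iff]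
  intro O hO hyO
  obtain ⟨_, ⟨hzO, hzV⟩, n, rfl⟩ :=
    mem_closure_iff.1 (hmin hyK) (O ∩ V) (hO.inter hV) ⟨hyO, hyV⟩
  obtain ⟨j, rfl | rfl⟩ := Nat.even_or_odd' n
  · exact ⟨_, hzO, j, congrFun (Function.iterate_mul f 2 j).symm x⟩
  · exact absurd hzV (hodd j)

end Minimal

theorem sum_range_two_mul (h : ℕ → ℝ) (M : ℕ) :
    ∑ i ∈ Finset.range (2 * M), h i =
      ∑ i ∈ Finset.range M, h (2 * i) + ∑ i ∈ Finset.range M, h (2 * i + 1) := by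
  induction M with
  | zero => simp
  | succ M ih =>
    rw [Nat.mul_succ, Finset.sum_range_succ, Finset.sum_range_succ, ih, Finset.sum_range_succ,
      Finset.sum_range_succ]
    ring

/-- Nearby points of a minimal set of an interval map without horseshoes travel together: over
`2 ^ k` steps the sum of their distances is on average at most the length of an interval
containing the set. -/
theorem exists_sum_dist_iterate_le {a b : ℝ} (k : ℕ) :
    ∀ (f : ℝ → ℝ) (K : Set ℝ) (c d : ℝ), ContinuousOn f (Set.Icc a b) →
      Set.MapsTo f (Set.Icc a b) (Set.Icc a b) → ¬ HasIterateHorseshoe f a b →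
      K ⊆ Set.Icc a b → K ⊆ Set.Icc c d → IsClosed K → Set.MapsTo f K K →
      (∀ x ∈ K, K ⊆ closure (Set.range fun n : ℕ => f^[n] x)) →
      ∃ δ > (0 : ℝ), ∀ u ∈ K, ∀ v ∈ K, |u - v| < δ → ∀ N : ℕ,
        ∑ i ∈ Finset.range (2 ^ k * N), |f^[i] u - f^[i] v| ≤ N * (d - c) := by
  induction k with
  | zero =>
    intro f K c d _ _ _ _ hKcd _ hKinv _
    refine ⟨1, one_pos, fun u hu v hv _ N => ?_⟩
    have hb : ∀ i ∈ Finset.range (2 ^ 0 * N), |f^[i] u - f^[i] v| ≤ d - c := fun i _ =>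
      Real.dist_le_of_mem_Icc (hKcd (hKinv.iterate i hu)) (hKcd (hKinv.iterate i hv))
    simpa using Finset.sum_le_card_nsmul _ _ _ hb
  | succ k ih =>
    intro f K c d hf hmaps hhs hK hKcd hKcl hKinv hmin
    rcases K.subsingleton_or_nontrivial with hsub | hnt
    · refine ⟨1, one_pos, fun u hu v hv _ N => ?_⟩
      have hcd : c ≤ d := (hKcd hu).1.trans (hKcd hu).2
      rw [hsub hu hv]
      simpa using mul_nonneg (Nat.cast_nonneg N) (sub_nonneg.2 hcd)
    obtain ⟨l, r, hlr, hswap⟩ := exists_swapped_halves hf hmaps hhs hK hKcl hKinv hmin hnt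
    have hf2 := hf.iterate hmaps 2
    have hmaps2 := hmaps.iterate 2
    have hhs2 : ¬ HasIterateHorseshoe f^[2] a b := fun h => hhs h.of_iterate
    have hL : ∀ x ∈ K, x < r → x ≤ l ∧ r ≤ f x := fun x hx h =>
      (hswap x hx).resolve_right fun h' => absurd h'.1 (not_le.2 h)
    have hR : ∀ x ∈ K, l < x → r ≤ x ∧ f x ≤ l := fun x hx h =>
      (hswap x hx).resolve_left fun h' => absurd h'.1 (not_le.2 h)
    have hLinv : Set.MapsTo f^[2] (K ∩ Set.Iic l) (K ∩ Set.Iic l) := fun x hx =>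
      ⟨hKinv.iterate 2 hx.1, (hR _ (hKinv hx.1)
        (hlr.trans_le (hL x hx.1 (lt_of_le_of_lt hx.2 hlr)).2)).2⟩
    have hRinv : Set.MapsTo f^[2] (K ∩ Set.Ici r) (K ∩ Set.Ici r) := fun x hx =>
      ⟨hKinv.iterate 2 hx.1, (hL _ (hKinv hx.1)
        (lt_of_le_of_lt (hR x hx.1 (lt_of_lt_of_le hlr hx.2)).2 hlr)).2⟩
    have hLmin : ∀ x ∈ K ∩ Set.Iic l,
        K ∩ Set.Iic l ⊆ closure (Set.range fun n : ℕ => (f^[2])^[n] x) := by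
      intro x hx
      refine (Set.inter_subset_inter_right K (Set.Iic_subset_Iio.2 hlr)).trans
        (subset_closure_range_iterate_two isOpen_Iio (hmin x hx.1) fun j => ?_)
      have hj := hLinv.iterate j hx
      rw [Function.iterate_succ_apply', Function.iterate_mul, Set.mem_Iio, not_lt]
      exact (hL _ hj.1 (lt_of_le_of_lt hj.2 hlr)).2
    have hRmin : ∀ x ∈ K ∩ Set.Ici r,
        K ∩ Set.Ici r ⊆ closure (Set.range fun n : ℕ => (f^[2])^[n] x) := by
      intro x hx
      refine (Set.inter_subset_inter_right K (Set.Ici_subset_Ioi.2 hlr)).trans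
        (subset_closure_range_iterate_two isOpen_Ioi (hmin x hx.1) fun j => ?_)
      have hj := hRinv.iterate j hx
      rw [Function.iterate_succ_apply', Function.iterate_mul, Set.mem_Ioi, not_lt]
      exact (hR _ hj.1 (lt_of_lt_of_le hlr hj.2)).2
    obtain ⟨δ₀, hδ₀, h₀⟩ := ih f^[2] (K ∩ Set.Iic l) c l hf2 hmaps2 hhs2
      (Set.inter_subset_left.trans hK) (fun x hx => ⟨(hKcd hx.1).1, hx.2⟩)
      (hKcl.inter isClosed_Iic) hLinv hLmin
    obtain ⟨δ₁, hδ₁, h₁⟩ := ih f^[2] (K ∩ Set.Ici r) r d hf2 hmaps2 hhs2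
      (Set.inter_subset_left.trans hK) (fun x hx => ⟨hx.2, (hKcd hx.1).2⟩)
      (hKcl.inter isClosed_Ici) hRinv hRmin
    have huc : UniformContinuousOn f K :=
      (isCompact_Icc.of_isClosed_subset hKcl hK).uniformContinuousOn_of_continuous (hf.mono hK)
    obtain ⟨δ₂, hδ₂, h₂⟩ := Metric.uniformContinuousOn_iff.1 huc (min δ₀ δ₁) (lt_min hδ₀ hδ₁)
    refine ⟨min (min δ₀ δ₁) (min δ₂ (r - l)),
      lt_min (lt_min hδ₀ hδ₁) (lt_min hδ₂ (sub_pos.2 hlr)), fun u hu v hv huv N => ?_⟩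
    simp only [lt_min_iff] at huv
    obtain ⟨⟨huv₀, huv₁⟩, huv₂, huvg⟩ := huv
    have hfuv := h₂ u hu v hv huv₂
    rw [Real.dist_eq, lt_min_iff] at hfuv
    rw [abs_lt] at huvg
    have hN : (N : ℝ) * (l - c) + N * (d - r) ≤ N * (d - c) := by
      rw [← mul_add]
      exact mul_le_mul_of_nonneg_left (by linarith) (Nat.cast_nonneg N)
    rw [show 2 ^ (k + 1) * N = 2 * (2 ^ k * N) by ring, sum_range_two_mul]
    simp only [Function.iterate_succ_apply, Function.iterate_mul]
    rcases hswap u hu with hu' | hu' <;> rcases hswap v hv with hv' | hv'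
    · linarith [h₀ u ⟨hu, hu'.1⟩ v ⟨hv, hv'.1⟩ huv₀ N,
        h₁ (f u) ⟨hKinv hu, hu'.2⟩ (f v) ⟨hKinv hv, hv'.2⟩ hfuv.2 N]
    · linarith [hu'.1, hv'.1]
    · linarith [hu'.1, hv'.1]
    · linarith [h₁ u ⟨hu, hu'.1⟩ v ⟨hv, hv'.1⟩ huv₁ N,
        h₀ (f u) ⟨hKinv hu, hu'.2⟩ (f v) ⟨hKinv hv, hv'.2⟩ hfuv.1 N]

/-- A set of times at which a nonnegative sequence is at least `ε` has upper density controlled by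
the averages of the sequence over blocks of length `q`. -/
theorem upperDensity_le_of_sum_le {h : ℕ → ℝ} {ε C : ℝ} {q : ℕ} (hε : 0 < ε) (hq : 0 < q)
    (h0 : ∀ n, 0 ≤ h n) (hC : 0 ≤ C)
    (hsum : ∀ N : ℕ, ∑ i ∈ Finset.range (q * N), h i ≤ N * C) :
    upperDensity {n | ε ≤ h n} ≤ C / (ε * q) := by
  classical
  have hq' : (0 : ℝ) < q := Nat.cast_pos.2 hq
  set s : ℕ → ℝ := fun N =>
    (∑ n ∈ Finset.Icc 1 N, if n ∈ {n | ε ≤ h n} then (1 : ℝ) else 0) / N with hs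
  have hbound : ∀ᶠ N : ℕ in atTop, s N ≤ C / (ε * q) + C / ε / N := by
    filter_upwards [eventually_gt_atTop 0] with N hN
    have hN' : (0 : ℝ) < N := Nat.cast_pos.2 hN
    have h1 : ∑ n ∈ Finset.Icc 1 N, (if n ∈ {n | ε ≤ h n} then (1 : ℝ) else 0) ≤
        ∑ n ∈ Finset.Icc 1 N, h n / ε := by
      refine Finset.sum_le_sum fun n _ => ?_
      split_ifs with hn
      · exact (one_le_div hε).2 hn
      · exact div_nonneg (h0 n) hε.le
    have h2 : ∑ n ∈ Finset.Icc 1 N, h n ≤ ∑ n ∈ Finset.range (q * (N / q + 1)), h n := by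
      refine Finset.sum_le_sum_of_subset_of_nonneg (fun n hn => ?_) fun n _ _ => h0 n
      rw [Finset.mem_range]
      exact (Finset.mem_Icc.1 hn).2.trans_lt (Nat.lt_mul_div_succ N hq)
    have h3 : ((N / q + 1 : ℕ) : ℝ) * C ≤ (N / q + 1) * C := by
      push_cast
      gcongr
      exact Nat.cast_div_le
    have h4 := (h2.trans (hsum _)).trans h3
    rw [← Finset.sum_div] at h1
    calc s N ≤ (N / q + 1) * C / ε / N := by
          rw [hs]
          dsimp only
          gcongr
          exact h1.trans (by gcongr)
      _ = C / (ε * q) + C / ε / N := by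
          field_simp
  have hlim : Tendsto (fun N : ℕ => C / (ε * q) + C / ε / N) atTop (nhds (C / (ε * q))) := by
    simpa using tendsto_const_nhds.add (tendsto_const_div_atTop_nhds_zero_nat (C / ε))
  have hlow : ∀ N, 0 ≤ s N := fun N =>
    div_nonneg (Finset.sum_nonneg fun n _ => by split_ifs <;> norm_num) (Nat.cast_nonneg N)
  have hle : limsup s atTop ≤ C / (ε * q) := by
    rw [← hlim.limsup_eq]
    exact limsup_le_limsup hbound (isCoboundedUnder_le_of_le atTop hlow) hlim.isBoundedUnder_le
  unfold upperDensity
  convert hle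

/-- Suppose `f` is a continuous interval map with zero topological entropy and `K` a
minimal set for `f`. Then the sub-flow `(K, f|K)` is mean-L-stable: for every `ε > 0`
there is `δ > 0` such that for `u, v ∈ K` with `|u − v| < δ`, `|fⁿu − fⁿv| < ε` holds
for all `n` outside a set of upper density less than `ε`. -/
theorem zero_entropy_minimal_MLS (a b : ℝ) (f : ℝ → ℝ)
    (hf : ContinuousOn f (Set.Icc a b))
    (hmaps : Set.MapsTo f (Set.Icc a b) (Set.Icc a b))
    (hent : coverEntropy f (Set.Icc a b) = 0)
    (K : Set ℝ) (hK : K ⊆ Set.Icc a b) (hKne : K.Nonempty) (hKcl : IsClosed K)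
    (hKinv : Set.MapsTo f K K)
    (hmin : ∀ x ∈ K, K ⊆ closure (Set.range fun n : ℕ => f^[n] x)) :
    ∀ ε > (0 : ℝ), ∃ δ > (0 : ℝ), ∀ u ∈ K, ∀ v ∈ K, |u - v| < δ →
      ∃ E : Set ℕ, upperDensity E < ε ∧ ∀ n ∉ E, |f^[n] u - f^[n] v| < ε := by
  intro ε hε
  have hhs := not_hasIterateHorseshoe_of_coverEntropy_eq_zero hf hmaps hent
  have hab : 0 ≤ b - a := sub_nonneg.2 (hKne.elim fun x hx => (hK hx).1.trans (hK hx).2)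
  obtain ⟨k, hk⟩ := pow_unbounded_of_one_lt ((b - a) / (ε * ε)) (one_lt_two (α := ℝ))
  obtain ⟨δ, hδ, h⟩ := exists_sum_dist_iterate_le k f K a b hf hmaps hhs hK hK hKcl hKinv hmin
  refine ⟨δ, hδ, fun u hu v hv huv => ⟨{n | ε ≤ |f^[n] u - f^[n] v|}, ?_, fun n hn => not_le.1 hn⟩⟩
  refine (upperDensity_le_of_sum_le hε (pow_pos two_pos k) (fun n => abs_nonneg _) hab
    (h u hu v hv huv)).trans_lt ?_
  rw [div_lt_iff₀ (mul_pos hε hε)] at hk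
  push_cast
  rw [div_lt_iff₀ (by positivity)]
  linarith
end
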